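/- Let d ≥ 2 and let F = [[α,β],[γ,δ]] be an integer matrix with αδ − βγ ≡ 1 (mod d̄) which is prime, i.e. β ≠ 0 and gcd(β, d̄) = 1, and let β⁻¹ be an integer with β⁻¹β ≡ 1 (mod d̄). Then the d×d matrix V_F = (1/√d) Σ_{r,s=0}^{d−1} τ^{β⁻¹(α s² − 2rs + δ r²)} |e_r⟩⟨e_s| is unitary and satisfies V_F D_p V_F† = D_{Fp} for all p ∈ ℤ². -/

import Mathlib

noncomputable section
open Matrix Complex

/-- `d̄ = d` for odd `d`, `2d` for even `d`. -/
def dbar (d : ℕ) : ℕ := if d % 2 = 1 then d else 2 * d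

/-- `ω = exp(2πi/d)`. -/
def omega (d : ℕ) : ℂ := Complex.exp (2 * Real.pi * Complex.I / d)

/-- `τ = −exp(πi/d)`. -/
def tau (d : ℕ) : ℂ := -Complex.exp (Real.pi * Complex.I / d)

/-- The diagonal matrix `T e_r = ω^r e_r`. -/
def Tmat (d : ℕ) : Matrix (Fin d) (Fin d) ℂ :=
  Matrix.diagonal fun r => omega d ^ (r : ℕ)

/-- The cyclic shift `S e_r = e_{r+1 mod d}`. -/
def Smat (d : ℕ) : Matrix (Fin d) (Fin d) ℂ :=
  Matrix.of fun r s => if (r : ℕ) = ((s : ℕ) + 1) % d then 1 else 0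

/-- The displacement operators `D_p = τ^{p₁p₂} S^{p₁} T^{p₂}`. -/
def Dmat (d : ℕ) (p : ℤ × ℤ) : Matrix (Fin d) (Fin d) ℂ :=
  tau d ^ (p.1 * p.2) • (Smat d ^ p.1 * Tmat d ^ p.2)

/-- The symplectic form `⟨p,q⟩ = p₂q₁ − p₁q₂`. -/
def symp (p q : ℤ × ℤ) : ℤ := p.2 * q.1 - p.1 * q.2

/-- Action of a 2×2 integer matrix on `ℤ²`. -/
def Fapp (F : Matrix (Fin 2) (Fin 2) ℤ) (p : ℤ × ℤ) : ℤ × ℤ :=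
  (F 0 0 * p.1 + F 0 1 * p.2, F 1 0 * p.1 + F 1 1 * p.2)

/-- The generalized Pauli group `W(d) = {e^{iξ} D_p}`, as a set of matrices. -/
def Wset (d : ℕ) : Set (Matrix (Fin d) (Fin d) ℂ) :=
  {M | ∃ ξ : ℝ, ∃ p : ℤ × ℤ, M = Complex.exp (ξ * Complex.I) • Dmat d p}

theorem dbar_dvd_two_mul (d : ℕ) : (dbar d : ℤ) ∣ 2 * d := by
  unfold dbar
  split_ifs
  · exact Dvd.intro_left _ rfl
  · push_cast; rfl

theorem dbar_dvd_mul_self (d : ℕ) : (dbar d : ℤ) ∣ d * d := by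
  unfold dbar
  split_ifs with h
  · exact Dvd.intro_left _ rfl
  · obtain ⟨k, hk⟩ : 2 ∣ d := by omega
    refine ⟨k, ?_⟩
    push_cast
    nth_rewrite 2 [hk]
    push_cast
    ring

theorem dvd_dbar (d : ℕ) : (d : ℤ) ∣ dbar d := by
  unfold dbar
  split_ifs
  · rfl
  · push_cast; exact Dvd.intro_left _ rfl

theorem tau_ne_zero (d : ℕ) : tau d ≠ 0 := neg_ne_zero.2 (Complex.exp_ne_zero _)

theorem tau_sq (d : ℕ) : tau d ^ 2 = omega d := by
  rw [tau, omega, neg_sq, ← Complex.exp_nat_mul]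
  congr 1
  push_cast
  ring

theorem omega_zpow (d : ℕ) (z : ℤ) : omega d ^ z = tau d ^ (2 * z) := by
  rw [← tau_sq, _root_.zpow_mul]
  rfl

theorem star_tau (d : ℕ) : star (tau d) = (tau d)⁻¹ := by
  rw [tau, star_neg, inv_neg, ← Complex.exp_neg, Complex.star_def, ← Complex.exp_conj]
  simp [neg_div]

theorem star_tau_zpow (d : ℕ) (z : ℤ) : star (tau d ^ z) = tau d ^ (-z) := by
  rw [star_zpow₀, star_tau, _root_.inv_zpow, _root_.zpow_neg]

theorem tau_pow_dbar {d : ℕ} (hd : d ≠ 0) : tau d ^ dbar d = 1 := by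
  have hd' : (d : ℂ) ≠ 0 := Nat.cast_ne_zero.2 hd
  unfold dbar
  split_ifs with h
  · rw [tau, (Nat.odd_iff.2 h).neg_pow, ← Complex.exp_nat_mul, mul_div_cancel₀ _ hd',
      Complex.exp_pi_mul_I, neg_neg]
  · rw [pow_mul, tau_sq, omega, ← Complex.exp_nat_mul, mul_div_cancel₀ _ hd',
      Complex.exp_two_pi_mul_I]

theorem tau_zpow_congr {d : ℕ} (hd : d ≠ 0) {a b : ℤ} (h : a ≡ b [ZMOD (dbar d)]) :
    tau d ^ a = tau d ^ b := by
  obtain ⟨k, hk⟩ := h.dvd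
  obtain rfl : b = a + dbar d * k := by omega
  rw [zpow_add₀ (tau_ne_zero d), _root_.zpow_mul, zpow_natCast, tau_pow_dbar hd, _root_.one_zpow, mul_one]

/-- Exponentials of quadratic polynomials with even linear coefficient are `d`-periodic. -/
theorem tau_zpow_quadratic_congr {d : ℕ} (hd : d ≠ 0) (a b c : ℤ) {x y : ℤ}
    (h : x ≡ y [ZMOD d]) :
    tau d ^ (a * x ^ 2 + 2 * b * x + c) = tau d ^ (a * y ^ 2 + 2 * b * y + c) := by
  apply tau_zpow_congr hd
  obtain ⟨k, hk⟩ := h.dvd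
  obtain rfl : y = x + d * k := by omega
  obtain ⟨u, hu⟩ := dbar_dvd_two_mul d
  obtain ⟨v, hv⟩ := dbar_dvd_mul_self d
  refine Int.modEq_iff_dvd.2 ⟨a * (u * k * x + v * k ^ 2) + b * u * k, ?_⟩
  linear_combination (a * k * x + b * k) * hu + a * k ^ 2 * hv

theorem sum_ite_modEq {d : ℕ} (hd : d ≠ 0) (g : ℤ → ℂ)
    (hg : ∀ x y : ℤ, x ≡ y [ZMOD d] → g x = g y) (a : ℤ) :
    ∑ t : Fin d, (if ((t : ℕ) : ℤ) ≡ a [ZMOD d] then g (t : ℕ) else 0) = g a := by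
  have hd' : (0 : ℤ) < d := by omega
  have h0 := Int.emod_nonneg a hd'.ne'
  have h1 := Int.emod_lt_of_pos a hd'
  let t₀ : Fin d := ⟨(a % d).toNat, by omega⟩
  have ht₀ : ((t₀ : ℕ) : ℤ) = a % d := Int.toNat_of_nonneg h0
  have hmod : ((t₀ : ℕ) : ℤ) ≡ a [ZMOD d] := by rw [ht₀]; exact Int.mod_modEq a d
  rw [Finset.sum_eq_single t₀, if_pos hmod, hg _ _ hmod]
  · intro t _ ht
    refine if_neg fun h => ht (Fin.ext ?_)
    have := h.trans hmod.symm
    exact Nat.ModEq.eq_of_lt_of_lt (Int.natCast_modEq_iff.1 this) t.2 t₀.2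
  · simp

/-- The power `S ^ z` of the cyclic shift. -/
def shiftMat (d : ℕ) (z : ℤ) : Matrix (Fin d) (Fin d) ℂ :=
  Matrix.of fun r s => if ((r : ℕ) : ℤ) ≡ (s : ℕ) + z [ZMOD d] then 1 else 0

theorem fin_modEq_iff {d : ℕ} (r s : Fin d) :
    ((r : ℕ) : ℤ) ≡ (s : ℕ) [ZMOD d] ↔ r = s :=
  ⟨fun h => Fin.ext (Nat.ModEq.eq_of_lt_of_lt (Int.natCast_modEq_iff.1 h) r.2 s.2),
    fun h => h ▸ rfl⟩

theorem of_mul_shiftMat {d : ℕ} (hd : d ≠ 0) (f : Fin d → ℤ → ℂ)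
    (hf : ∀ r x y, x ≡ y [ZMOD d] → f r x = f r y) (z : ℤ) :
    (Matrix.of fun r s : Fin d => f r (s : ℕ)) * shiftMat d z =
      Matrix.of fun r s : Fin d => f r ((s : ℕ) + z) := by
  ext r s
  simp only [Matrix.mul_apply, shiftMat, Matrix.of_apply, mul_ite, mul_one, mul_zero]
  exact sum_ite_modEq hd (f r) (hf r) _

theorem shiftMat_mul_of {d : ℕ} (hd : d ≠ 0) (f : ℤ → Fin d → ℂ)
    (hf : ∀ s x y, x ≡ y [ZMOD d] → f x s = f y s) (z : ℤ) :
    shiftMat d z * (Matrix.of fun r s : Fin d => f (r : ℕ) s) =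
      Matrix.of fun r s : Fin d => f ((r : ℕ) - z) s := by
  ext r s
  simp only [Matrix.mul_apply, shiftMat, Matrix.of_apply, ite_mul, one_mul, zero_mul]
  rw [← sum_ite_modEq hd (fun x => f x s) (hf s)]
  refine Finset.sum_congr rfl fun t _ => if_congr ?_ rfl rfl
  rw [Int.modEq_iff_dvd, Int.modEq_comm, Int.modEq_iff_dvd]
  ring_nf

theorem shiftMat_zero (d : ℕ) : shiftMat d 0 = 1 := by
  ext r s
  simp only [shiftMat, Matrix.of_apply, add_zero, fin_modEq_iff, Matrix.one_apply]

theorem shiftMat_add {d : ℕ} (hd : d ≠ 0) (z w : ℤ) :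
    shiftMat d (z + w) = shiftMat d z * shiftMat d w := by
  have h := of_mul_shiftMat hd
    (fun r x => if ((r : ℕ) : ℤ) ≡ x + z [ZMOD d] then 1 else 0) (fun r x y hxy => by
      have := hxy.add_right z
      exact if_congr ⟨fun h => h.trans this, fun h => h.trans this.symm⟩ rfl rfl) w
  refine Eq.trans ?_ h.symm
  ext r s
  simp only [shiftMat, Matrix.of_apply, add_assoc, add_comm]

theorem shiftMat_one (d : ℕ) : shiftMat d 1 = Smat d := by
  ext r s
  simp only [shiftMat, Smat, Matrix.of_apply]
  refine if_congr ?_ rfl rfl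
  rw [← Nat.cast_one, ← Nat.cast_add, Int.natCast_modEq_iff, Nat.ModEq, Nat.mod_eq_of_lt r.2]

/-- A one-parameter family of matrices indexed by `ℤ` consists of the powers of its generator. -/
theorem zpow_eq_of_add {n : Type*} [Fintype n] [DecidableEq n] (P : ℤ → Matrix n n ℂ)
    (h0 : P 0 = 1) (hadd : ∀ z w, P (z + w) = P z * P w) (z : ℤ) : P 1 ^ z = P z := by
  have hnat (k : ℕ) : P 1 ^ k = P k := by
    induction k with
    | zero => simp [h0]
    | succ k ih => rw [pow_succ, ih, Nat.cast_succ, hadd]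
  obtain ⟨k, rfl | rfl⟩ := z.eq_nat_or_neg
  · rw [zpow_natCast, hnat]
  · rw [Matrix.zpow_neg_natCast, hnat]
    exact Matrix.inv_eq_right_inv (by rw [← hadd, add_neg_cancel, h0])

theorem Smat_zpow {d : ℕ} (hd : d ≠ 0) (z : ℤ) : Smat d ^ z = shiftMat d z := by
  rw [← shiftMat_one]
  exact zpow_eq_of_add _ (shiftMat_zero d) (shiftMat_add hd) z

theorem Tmat_zpow (d : ℕ) (z : ℤ) :
    Tmat d ^ z = Matrix.diagonal fun r : Fin d => tau d ^ (2 * z * (r : ℕ)) := by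
  have h := zpow_eq_of_add (fun z => Matrix.diagonal fun r : Fin d => tau d ^ (2 * z * (r : ℕ)))
    (by simp) (fun z w => by
      simp only [Matrix.diagonal_mul_diagonal, ← zpow_add₀ (tau_ne_zero d)]
      congr! 3
      ring) z
  rw [← h, Tmat]
  congr! 3 with r
  rw [← zpow_natCast, omega_zpow, mul_one]

/-- The matrix `√d V_F`, in terms of `b = β⁻¹`. -/
def phaseMat (d : ℕ) (α δ b : ℤ) : Matrix (Fin d) (Fin d) ℂ :=
  Matrix.of fun r s =>
    tau d ^ (b * (α * (s : ℕ) ^ 2 - 2 * (r : ℕ) * (s : ℕ) + δ * (r : ℕ) ^ 2))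

theorem phaseMat_mul_Dmat {d : ℕ} (hd : d ≠ 0) (α δ b : ℤ) (p : ℤ × ℤ) :
    phaseMat d α δ b * Dmat d p = Matrix.of fun r s : Fin d =>
      tau d ^ (p.1 * p.2 + 2 * p.2 * (s : ℕ) + b * (α * ((s : ℕ) + p.1) ^ 2
        - 2 * (r : ℕ) * ((s : ℕ) + p.1) + δ * (r : ℕ) ^ 2)) := by
  have h := of_mul_shiftMat hd
    (fun r x => tau d ^ (b * (α * x ^ 2 - 2 * (r : ℕ) * x + δ * (r : ℕ) ^ 2)))
    (fun r x y hxy => by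
      convert tau_zpow_quadratic_congr hd (b * α) (-b * (r : ℕ)) (b * δ * (r : ℕ) ^ 2) hxy
        using 2 <;> ring) p.1
  rw [Dmat, Smat_zpow hd, Tmat_zpow, Matrix.mul_smul, ← Matrix.mul_assoc, phaseMat, h]
  ext r s
  simp only [Matrix.smul_apply, Matrix.mul_diagonal, Matrix.of_apply, smul_eq_mul,
    ← zpow_add₀ (tau_ne_zero d)]
  congr 1
  ring

theorem Dmat_mul_phaseMat {d : ℕ} (hd : d ≠ 0) (α δ b : ℤ) (p : ℤ × ℤ) :
    Dmat d p * phaseMat d α δ b = Matrix.of fun r s : Fin d =>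
      tau d ^ (p.1 * p.2 + 2 * p.2 * ((r : ℕ) - p.1) + b * (α * (s : ℕ) ^ 2
        - 2 * ((r : ℕ) - p.1) * (s : ℕ) + δ * ((r : ℕ) - p.1) ^ 2)) := by
  have h := shiftMat_mul_of hd
    (fun x s => tau d ^ (2 * p.2 * x) *
      tau d ^ (b * (α * (s : ℕ) ^ 2 - 2 * x * (s : ℕ) + δ * x ^ 2)))
    (fun s x y hxy => by
      simp only [← zpow_add₀ (tau_ne_zero d)]
      convert tau_zpow_quadratic_congr hd (b * δ) (p.2 - b * (s : ℕ)) (b * α * (s : ℕ) ^ 2) hxy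
        using 2 <;> ring) p.1
  have hT : (Matrix.diagonal fun r : Fin d => tau d ^ (2 * p.2 * (r : ℕ))) *
      phaseMat d α δ b = Matrix.of fun r s : Fin d => tau d ^ (2 * p.2 * (r : ℕ)) *
        tau d ^ (b * (α * (s : ℕ) ^ 2 - 2 * (r : ℕ) * (s : ℕ) + δ * (r : ℕ) ^ 2)) := by
    ext r s
    simp [phaseMat, Matrix.diagonal_mul]
  rw [Dmat, Smat_zpow hd, Tmat_zpow, Matrix.smul_mul, Matrix.mul_assoc, hT, h]
  ext r s
  simp only [Matrix.smul_apply, Matrix.of_apply, smul_eq_mul, ← zpow_add₀ (tau_ne_zero d)]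
  congr 1
  ring

theorem phaseMat_mul_Dmat_eq {d : ℕ} (hd : d ≠ 0) {α β γ δ b : ℤ}
    (hdet : α * δ - β * γ ≡ 1 [ZMOD (dbar d)]) (hb : b * β ≡ 1 [ZMOD (dbar d)]) (p : ℤ × ℤ) :
    phaseMat d α δ b * Dmat d p = Dmat d (Fapp !![α, β; γ, δ] p) * phaseMat d α δ b := by
  rw [phaseMat_mul_Dmat hd, Dmat_mul_phaseMat hd]
  ext r s
  apply tau_zpow_congr hd
  rw [← ZMod.intCast_eq_intCast_iff] at hdet hb ⊢
  simp only [Fapp, Matrix.of_apply, Matrix.cons_val', Matrix.cons_val_zero, Matrix.cons_val_one,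
    Matrix.cons_val_fin_one]
  push_cast at hdet hb ⊢
  grind

theorem sum_omega_zpow {d : ℕ} (hd : d ≠ 0) {z : ℤ} (hz : ¬ (d : ℤ) ∣ z) :
    ∑ t : Fin d, omega d ^ (z * (t : ℕ)) = 0 := by
  have hprim : IsPrimitiveRoot (omega d) d := Complex.isPrimitiveRoot_exp d hd
  have h1 : omega d ^ z ≠ 1 := fun h => hz ((hprim.zpow_eq_one_iff_dvd z).1 h)
  have h2 : (omega d ^ z) ^ d = 1 := by
    rw [← zpow_natCast, _root_.zpow_comm, zpow_natCast, hprim.pow_eq_one, _root_.one_zpow]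
  simp only [_root_.zpow_mul, zpow_natCast]
  rw [Fin.sum_univ_eq_sum_range (fun t => (omega d ^ z) ^ t), geom_sum_eq h1, h2, sub_self,
    zero_div]

theorem phaseMat_mul_conjTranspose {d : ℕ} (hd : d ≠ 0) (α δ : ℤ) {β b : ℤ}
    (hb : b * β ≡ 1 [ZMOD (dbar d)]) :
    phaseMat d α δ b * (phaseMat d α δ b)ᴴ = (d : ℂ) • 1 := by
  ext r s
  have hterm (t : Fin d) : phaseMat d α δ b r t * star (phaseMat d α δ b s t) =
      tau d ^ (b * δ * ((r : ℕ) ^ 2 - (s : ℕ) ^ 2)) *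
        omega d ^ (b * ((s : ℕ) - (r : ℕ)) * (t : ℕ)) := by
    simp only [phaseMat, Matrix.of_apply, star_tau_zpow, omega_zpow,
      ← zpow_add₀ (tau_ne_zero d)]
    congr 1
    ring
  simp only [Matrix.mul_apply, Matrix.conjTranspose_apply, hterm, ← Finset.mul_sum,
    Matrix.smul_apply, smul_eq_mul]
  by_cases hrs : r = s
  · subst hrs
    simp
  · rw [sum_omega_zpow hd, Matrix.one_apply_ne hrs, mul_zero, mul_zero]
    intro hdvd
    have hcop : IsCoprime (d : ℤ) b := by
      obtain ⟨k, hk⟩ := ((dvd_dbar d).trans hb.dvd)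
      exact ⟨k, β, by linear_combination -hk⟩
    exact hrs ((fin_modEq_iff r s).1 (Int.modEq_iff_dvd.2 (hcop.dvd_of_dvd_mul_left hdvd)))

/-- For a prime matrix `F = [[α,β],[γ,δ]]` (i.e. `det ≡ 1 (mod d̄)`,
`β ≠ 0`, `gcd(β,d̄)=1`) with `β⁻¹β ≡ 1 (mod d̄)`, the matrix
`V_F = (1/√d) Σ_{r,s} τ^{β⁻¹(αs² − 2rs + δr²)} |e_r⟩⟨e_s|` is unitary and satisfies
`V_F D_p V_F† = D_{Fp}` for all `p ∈ ℤ²`. -/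
theorem stmt1 (d : ℕ) (hd : 2 ≤ d) (α β γ δ βinv : ℤ)
    (hdet : α * δ - β * γ ≡ 1 [ZMOD (dbar d)])
    (hβ : β ≠ 0) (hgcd : Int.gcd β (dbar d) = 1)
    (hβinv : βinv * β ≡ 1 [ZMOD (dbar d)]) :
    (((Real.sqrt d : ℂ))⁻¹ •
        Matrix.of (fun r s : Fin d =>
          tau d ^ (βinv * (α * (s : ℕ) ^ 2 - 2 * (r : ℕ) * (s : ℕ) + δ * (r : ℕ) ^ 2))))
        ∈ Matrix.unitaryGroup (Fin d) ℂ ∧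
      ∀ p : ℤ × ℤ,
        (((Real.sqrt d : ℂ))⁻¹ •
            Matrix.of (fun r s : Fin d =>
              tau d ^ (βinv * (α * (s : ℕ) ^ 2 - 2 * (r : ℕ) * (s : ℕ) + δ * (r : ℕ) ^ 2)))) *
          Dmat d p *
          (((Real.sqrt d : ℂ))⁻¹ •
            Matrix.of (fun r s : Fin d =>
              tau d ^ (βinv * (α * (s : ℕ) ^ 2 - 2 * (r : ℕ) * (s : ℕ) + δ * (r : ℕ) ^ 2))))ᴴ =
          Dmat d (Fapp !![α, β; γ, δ] p) := by
  have hd0 : d ≠ 0 := by omega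
  change ((Real.sqrt d : ℂ)⁻¹ • phaseMat d α δ βinv) ∈ Matrix.unitaryGroup (Fin d) ℂ ∧
    ∀ p : ℤ × ℤ, ((Real.sqrt d : ℂ)⁻¹ • phaseMat d α δ βinv) * Dmat d p *
      ((Real.sqrt d : ℂ)⁻¹ • phaseMat d α δ βinv)ᴴ = Dmat d (Fapp !![α, β; γ, δ] p)
  have hU : ((Real.sqrt d : ℂ)⁻¹ • phaseMat d α δ βinv) *
      ((Real.sqrt d : ℂ)⁻¹ • phaseMat d α δ βinv)ᴴ = 1 := by
    have hsq : (Real.sqrt d : ℂ) * Real.sqrt d = d := by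
      rw [← Complex.ofReal_mul, Real.mul_self_sqrt (Nat.cast_nonneg d), Complex.ofReal_natCast]
    have hstar : star (Real.sqrt d : ℂ)⁻¹ = (Real.sqrt d : ℂ)⁻¹ := by
      rw [star_inv₀, Complex.star_def, Complex.conj_ofReal]
    rw [Matrix.conjTranspose_smul, hstar, Matrix.smul_mul, Matrix.mul_smul,
      phaseMat_mul_conjTranspose hd0 α δ hβinv, smul_smul, smul_smul, ← mul_inv, hsq,
      inv_mul_cancel₀ (Nat.cast_ne_zero.2 hd0), one_smul]
  refine ⟨Matrix.mem_unitaryGroup_iff.2 hU, fun p => ?_⟩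
  rw [Matrix.smul_mul, phaseMat_mul_Dmat_eq hd0 hdet hβinv, ← Matrix.mul_smul, Matrix.mul_assoc,
    hU, Matrix.mul_one]
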